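/- Let Γ, Ω and X be standard Borel spaces, μ a probability measure on Γ, and φ : Γ → Ω a measurable map. Let κ = condDistrib id φ μ be the regular conditional distribution of μ along φ, and let π be the measure on Γ × Γ given by (μ.map φ).bind (fun ω => (κ ω).prod (κ ω)) (the relatively independent self-product of Γ over Ω). If x : Γ → X is measurable and x ∘ Prod.fst = x ∘ Prod.snd holds π-almost everywhere, then there exists a measurable map q : Ω → X such that x = q ∘ φ holds μ-almost everywhere. -/

import Mathlib

open MeasureTheory ProbabilityTheory

/-- If two independent samples of a probability measure `ν` almost surely have the same image
under `x`, then `ν`-almost every value of a real function `f` of `x` equals its mean. -/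
theorem ae_eq_integral_of_ae_prod_eq {Γ X : Type*} [MeasurableSpace Γ]
    {ν : Measure Γ} [IsProbabilityMeasure ν] {x : Γ → X} (f : X → ℝ)
    (h : ∀ᵐ p ∂ν.prod ν, x p.1 = x p.2) :
    ∀ᵐ a ∂ν, f (x a) = ∫ b, f (x b) ∂ν := by
  filter_upwards [Measure.ae_ae_of_ae_prod h] with a ha
  have hconst : (fun b => f (x b)) =ᵐ[ν] fun _ => f (x a) := by
    filter_upwards [ha] with b hb
    rw [hb]
  simp [integral_congr_ae hconst]

/-- Gluing along the relatively independent self-product: if `x : Γ → X` is measurable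
and its two pullbacks to the relatively independent self-product of `Γ` over `Ω` agree
almost everywhere, then `x` factors almost everywhere through `φ` by a measurable map. -/
theorem exists_factorization_of_ae_eq_on_relIndep_self_product
    {Γ Ω X : Type*}
    [MeasurableSpace Γ] [StandardBorelSpace Γ] [Nonempty Γ]
    [MeasurableSpace Ω] [StandardBorelSpace Ω]
    [MeasurableSpace X] [StandardBorelSpace X]
    (μ : Measure Γ) [IsProbabilityMeasure μ]
    (φ : Γ → Ω) (hφ : Measurable φ)
    (x : Γ → X) (hx : Measurable x)
    (hinv : (fun p : Γ × Γ => x p.1)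
        =ᵐ[(μ.map φ).bind fun ω =>
            ((condDistrib id φ μ) ω).prod ((condDistrib id φ μ) ω)]
      (fun p : Γ × Γ => x p.2)) :
    ∃ q : Ω → X, Measurable q ∧ x =ᵐ[μ] q ∘ φ := by
  have he := measurableEmbedding_embeddingReal X
  have hf : Measurable fun γ => embeddingReal X (x γ) := he.measurable.comp hx
  obtain ⟨g, hg, hge⟩ := he.exists_measurable_extend measurable_id
    fun _ => (inferInstance : Nonempty Γ).map x
  have hm : Measurable fun ω => ∫ γ, embeddingReal X (x γ) ∂condDistrib id φ μ ω :=
    (hf.comp measurable_snd).stronglyMeasurable.integral_condDistrib.measurable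
  refine ⟨fun ω => g (∫ γ, embeddingReal X (x γ) ∂condDistrib id φ μ ω), hg.comp hm, ?_⟩
  have hbind : ∀ᵐ ω ∂μ.map φ,
      ∀ᵐ p ∂(condDistrib id φ μ ω).prod (condDistrib id φ μ ω), x p.1 = x p.2 := by
    refine Measure.ae_ae_of_ae_bind ?_ hinv
    simp_rw [← Kernel.prod_apply]
    exact (condDistrib id φ μ ×ₖ condDistrib id φ μ).measurable.aemeasurable
  have hcomp : ∀ᵐ p ∂(μ.map φ) ⊗ₘ condDistrib id φ μ,
      embeddingReal X (x p.2) = ∫ b, embeddingReal X (x b) ∂condDistrib id φ μ p.1 := by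
    refine Measure.ae_compProd_of_ae_ae
      (measurableSet_eq_fun (hf.comp measurable_snd) (hm.comp measurable_fst)) ?_
    filter_upwards [hbind] with ω hω
    exact ae_eq_integral_of_ae_prod_eq (embeddingReal X) hω
  rw [compProd_map_condDistrib aemeasurable_id] at hcomp
  filter_upwards [ae_of_ae_map (hφ.prodMk measurable_id).aemeasurable hcomp] with γ hγ
  simpa [← hγ] using (congrFun hge (x γ)).symm
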